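/- Taking J = J' = I a monomial ideal of colength l in ℂ[y,z], the bound dim Hom(I, S/I) ≤ 2l holds; combined with the standard lower bound dim Hom(I, S/I) ≥ 2l for points of the Hilbert scheme of a smooth surface, this gives dim Hom_S(I, S/I) = 2l for every finite-colength monomial ideal I ⊆ ℂ[y,z]. -/

import Mathlib

open MvPolynomial

/-- A monomial ideal: an ideal generated by a set of monomials. -/
def IsMonomialIdeal (I : Ideal (MvPolynomial (Fin 2) ℂ)) : Prop :=
  ∃ G : Set (Fin 2 →₀ ℕ),
    I = Ideal.span ((fun d => (monomial d (1 : ℂ) : MvPolynomial (Fin 2) ℂ)) '' G)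

namespace HilbMon

abbrev S := MvPolynomial (Fin 2) ℂ

/-- The exponent vector `(a, b)`. -/
noncomputable def ex (a b : ℕ) : Fin 2 →₀ ℕ := Finsupp.single 0 a + Finsupp.single 1 b

@[simp] lemma ex_zero (a b : ℕ) : ex a b 0 = a := by simp [ex]

@[simp] lemma ex_one (a b : ℕ) : ex a b 1 = b := by simp [ex]

lemma ex_eta (d : Fin 2 →₀ ℕ) : ex (d 0) (d 1) = d := by
  ext i; fin_cases i <;> simp

lemma ex_monomial (a b : ℕ) : (monomial (ex a b) (1 : ℂ) : S) = X 0 ^ a * X 1 ^ b := by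
  rw [ex, X_pow_eq_monomial, X_pow_eq_monomial, monomial_mul, one_mul]

lemma monomial_eq' (d : Fin 2 →₀ ℕ) (c : ℂ) :
    (monomial d c : S) = c • (X 0 ^ d 0 * X 1 ^ d 1) := by
  rw [← ex_monomial, ex_eta, smul_monomial, smul_eq_mul, mul_one]

lemma linIndep (I : Ideal S)
    (hmem : ∀ p, p ∈ I ↔ ∀ d ∈ p.support, (monomial d (1 : ℂ) : S) ∈ I)
    {ι : Type*} (e : ι → (Fin 2 →₀ ℕ)) (he : Function.Injective e)
    (hI : ∀ i, (monomial (e i) (1 : ℂ) : S) ∉ I) :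
    LinearIndependent ℂ (fun i => Ideal.Quotient.mk I (monomial (e i) (1 : ℂ))) := by
  classical
  rw [linearIndependent_iff']
  intro s g hs i hi
  by_contra hg
  have h1 : Ideal.Quotient.mk I (∑ i ∈ s, monomial (e i) (g i)) = 0 := by
    rw [map_sum, ← hs]
    refine Finset.sum_congr rfl fun j _ => ?_
    rw [← mul_one (g j), ← smul_eq_mul, ← smul_monomial, smul_eq_mul, mul_one]
    rfl
  rw [Ideal.Quotient.eq_zero_iff_mem, hmem] at h1
  refine hI i (h1 (e i) ?_)
  rw [mem_support_iff, coeff_sum, Finset.sum_eq_single i]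
  · simpa using hg
  · intro j _ hj
    rw [coeff_monomial, if_neg (fun h => hj (he h))]
  · exact fun h => absurd hi h

lemma exists_data (I : Ideal S) (hI : IsMonomialIdeal I)
    (hfl : Module.Finite ℂ (S ⧸ I)) :
    ∃ (n : ℕ) (L : ℕ → ℕ), Antitone L ∧ L n = 0 ∧
      (∀ p, p ∈ I ↔ ∀ d ∈ p.support, L (d 0) ≤ d 1) ∧
      (∀ p, p ∈ I ↔ ∀ d ∈ p.support, (monomial d (1 : ℂ) : S) ∈ I) := by
  classical
  obtain ⟨G, hG⟩ := hI
  have h1 : ∀ p, p ∈ I ↔ ∀ d ∈ p.support, ∃ s ∈ G, s ≤ d := by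
    intro p
    rw [hG]; exact mem_ideal_span_monomial_image
  have h2 : ∀ d, (monomial d (1 : ℂ) : S) ∈ I ↔ ∃ s ∈ G, s ≤ d := by
    intro d
    rw [h1, support_monomial, if_neg one_ne_zero]; simp
  have hmem : ∀ p, p ∈ I ↔ ∀ d ∈ p.support, (monomial d (1 : ℂ) : S) ∈ I := by
    intro p; rw [h1]; simp only [h2]
  have hup : ∀ d d', d ≤ d' → (monomial d (1 : ℂ) : S) ∈ I → (monomial d' (1 : ℂ) : S) ∈ I := by
    intro d d' hd h
    rw [h2] at h ⊢
    obtain ⟨s, hs, hsd⟩ := h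
    exact ⟨s, hs, hsd.trans hd⟩
  have hex : ∀ a b a' b', a ≤ a' → b ≤ b' → ex a b ≤ ex a' b' := by
    intro a b a' b' h h' i
    fin_cases i <;> simpa
  have hfin : Finite {d : Fin 2 →₀ ℕ // (monomial d (1 : ℂ) : S) ∉ I} :=
    (linIndep I hmem (fun d : {d : Fin 2 →₀ ℕ // (monomial d (1 : ℂ) : S) ∉ I} => d.1)
      Subtype.val_injective (fun d => d.2)).finite
  have hset : Set.Finite {d : Fin 2 →₀ ℕ | (monomial d (1 : ℂ) : S) ∉ I} := hfin
  obtain ⟨N, hN⟩ := (hset.image (fun d => d 0 + d 1)).bddAbove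
  have hbig : ∀ a b, N < a + b → (monomial (ex a b) (1 : ℂ) : S) ∈ I := by
    intro a b hab
    by_contra hc
    have := hN ⟨ex a b, hc, rfl⟩
    simp at this
    omega
  have hE : ∀ a, ∃ b, (monomial (ex a b) (1 : ℂ) : S) ∈ I :=
    fun a => ⟨N + 1, hbig _ _ (by omega)⟩
  have hle : ∀ a b, (monomial (ex a b) (1 : ℂ) : S) ∈ I ↔ Nat.find (hE a) ≤ b := by
    intro a b
    refine ⟨fun h => Nat.find_le h, fun h => ?_⟩
    exact hup _ _ (hex _ _ _ _ le_rfl h) (Nat.find_spec (hE a))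
  refine ⟨N + 1, fun a => Nat.find (hE a), ?_, ?_, ?_, hmem⟩
  · intro a a' haa
    exact (hle a' _).1 (hup _ _ (hex _ _ _ _ haa le_rfl) (Nat.find_spec (hE a)))
  · exact Nat.le_zero.1 ((hle _ _).1 (hbig _ _ (by omega)))
  · intro p
    rw [hmem]
    refine forall₂_congr fun d _ => ?_
    rw [← hle, ex_eta]

section

variable {V : Type*} [CommRing V] [Algebra ℂ V]

/-- The transposed syzygy map. -/
def psi (n : ℕ) (L : ℕ → ℕ) (y z : V) : (Fin (n + 1) → V) →ₗ[ℂ] (Fin n → V) where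
  toFun f i := y * f i.castSucc - z ^ (L i - L (i + 1)) * f i.succ
  map_add' f g := by ext i; simp; ring
  map_smul' c f := by ext i; simp [smul_sub]

/-- Unit vectors. -/
def un (m i : ℕ) : V →ₗ[ℂ] (Fin m → V) where
  toFun v k := if (k : ℕ) = i then v else 0
  map_add' f g := by ext k; by_cases h : (k : ℕ) = i <;> simp [h]
  map_smul' c f := by ext k; by_cases h : (k : ℕ) = i <;> simp [h]

lemma psi_un_succ (n : ℕ) (L : ℕ → ℕ) (y z : V) (i : ℕ) (v : V) :
    psi n L y z (un (n + 1) (i + 1) v) =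
      un n (i + 1) (y * v) - un n i (z ^ (L i - L (i + 1)) * v) := by
  ext k
  simp only [psi, un, LinearMap.coe_mk, AddHom.coe_mk, Fin.val_castSucc, Fin.val_succ,
    Pi.sub_apply, add_left_inj]
  congr 1
  · split_ifs <;> simp
  · split_ifs with h
    · rw [h]
    · simp

lemma psi_un_zero (n : ℕ) (L : ℕ → ℕ) (y z : V) (v : V) :
    psi n L y z (un (n + 1) 0 v) = un n 0 (y * v) := by
  ext k
  simp only [psi, un, LinearMap.coe_mk, AddHom.coe_mk, Fin.val_castSucc, Fin.val_succ,
    Nat.succ_ne_zero, if_false, mul_zero, sub_zero]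
  split_ifs <;> simp

lemma claimA (n : ℕ) (L : ℕ → ℕ) (hL : Antitone L) (hn : L n = 0) (y z : V) (k : ℕ) :
    ∀ i, i + k = n → ∀ v, un n i (z ^ L i * v) ∈ LinearMap.range (psi n L y z) := by
  induction k with
  | zero =>
    intro i hi v
    have : un n i (z ^ L i * v) = (0 : Fin n → V) := by
      ext k
      simp only [un, LinearMap.coe_mk, AddHom.coe_mk, Pi.zero_apply]
      rw [if_neg]; have := k.2; omega
    rw [this]; exact zero_mem _
  | succ k ih =>
    intro i hi v
    have h1 := ih (i + 1) (by omega) (y * v)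
    have h2 := psi_un_succ n L y z i (z ^ L (i + 1) * v)
    have h3 : z ^ (L i - L (i + 1)) * (z ^ L (i + 1) * v) = z ^ L i * v := by
      rw [← mul_assoc, ← pow_add, Nat.sub_add_cancel (hL (Nat.le_succ i))]
    rw [h3] at h2
    have h4 : un n i (z ^ L i * v) = un n (i + 1) (z ^ L (i + 1) * (y * v))
        - psi n L y z (un (n + 1) (i + 1) (z ^ L (i + 1) * v)) := by
      rw [h2, mul_left_comm]; abel
    rw [h4]
    exact sub_mem h1 ⟨_, rfl⟩

/-- The spanning family of the cokernel. -/
def fam (n : ℕ) (L : ℕ → ℕ) (z : V) (d : Σ i : Fin n, Fin (L i)) : Fin n → V :=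
  un n d.1 (z ^ (d.2 : ℕ))

lemma claimB (n : ℕ) (L : ℕ → ℕ) (hL : Antitone L) (hn : L n = 0) (y z : V)
    (hspan : ∀ T : Submodule ℂ V, (∀ a b : ℕ, y ^ a * z ^ b ∈ T) → T = ⊤) (i : ℕ) :
    i < n → ∀ v, un n i v ∈
      LinearMap.range (psi n L y z) ⊔ Submodule.span ℂ (Set.range (fam n L z)) := by
  set T := LinearMap.range (psi n L y z) ⊔ Submodule.span ℂ (Set.range (fam n L z)) with hT
  have hr : LinearMap.range (psi n L y z) ≤ T := le_sup_left
  have key : ∀ i, i < n → (∀ v, un n i (y * v) ∈ T) → ∀ v, un n i v ∈ T := by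
    intro i hi hy v
    have : T.comap (un n i) = ⊤ := by
      refine hspan _ fun a b => ?_
      rw [Submodule.mem_comap]
      cases a with
      | succ a => rw [pow_succ', mul_assoc]; exact hy _
      | zero =>
        rw [pow_zero, one_mul]
        by_cases hb : b < L i
        · exact (le_sup_right : _ ≤ T) (Submodule.subset_span ⟨⟨⟨i, hi⟩, ⟨b, hb⟩⟩, rfl⟩)
        · have h := claimA n L hL hn y z (n - i) i (by omega) (z ^ (b - L i))
          rw [← pow_add, Nat.add_sub_cancel' (not_lt.1 hb)] at h
          exact hr h
    have h : v ∈ T.comap (un n i) := by rw [this]; trivial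
    exact h
  induction i with
  | zero =>
    intro hi
    refine key 0 hi fun v => hr ?_
    rw [← psi_un_zero n L y z v]; exact ⟨_, rfl⟩
  | succ i ih =>
    intro hi
    refine key _ hi fun v => ?_
    have h2 := psi_un_succ n L y z i v
    rw [eq_sub_iff_add_eq] at h2
    rw [← h2]
    exact add_mem (hr ⟨_, rfl⟩) (ih (by omega) _)

lemma upper [Module.Finite ℂ V] (n : ℕ) (L : ℕ → ℕ) (hL : Antitone L) (hn : L n = 0) (y z : V)
    (hspan : ∀ T : Submodule ℂ V, (∀ a b : ℕ, y ^ a * z ^ b ∈ T) → T = ⊤)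
    (hcard : Fintype.card (Σ i : Fin n, Fin (L i)) ≤ Module.finrank ℂ V) :
    n * Module.finrank ℂ V ≤
      Module.finrank ℂ (LinearMap.range (psi n L y z)) + Module.finrank ℂ V := by
  have htop : LinearMap.range (psi n L y z) ⊔ Submodule.span ℂ (Set.range (fam n L z)) = ⊤ := by
    rw [eq_top_iff]
    intro f _
    have : f = ∑ i : Fin n, un n i (f i) := by
      ext k
      simp [un, Finset.sum_apply, Fin.val_inj]
    rw [this]
    exact sum_mem fun i _ => claimB n L hL hn y z hspan i i.2 _
  have h1 := Submodule.finrank_add_le_finrank_add_finrank (LinearMap.range (psi n L y z))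
    (Submodule.span ℂ (Set.range (fam n L z)))
  rw [htop, finrank_top, Module.finrank_pi_fintype] at h1
  have h2 : Module.finrank ℂ (Submodule.span ℂ (Set.range (fam n L z))) ≤ _ :=
    finrank_range_le_card (R := ℂ) (fam n L z)
  simp at h1
  omega

/-- The pairing. -/
noncomputable def pair (n : ℕ) (ep : ℕ → V →ₗ[ℂ] ℂ) : V →ₗ[ℂ] Module.Dual ℂ (Fin n → V) :=
  ∑ i : Fin n, ((LinearMap.mul ℂ V).compr₂ (ep i)).compl₂ (LinearMap.proj i)

lemma pair_apply (n : ℕ) (ep : ℕ → V →ₗ[ℂ] ℂ) (w : V) (f : Fin n → V) :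
    pair n ep w f = ∑ i : Fin n, ep i (w * f i) := by
  simp [pair]

lemma lower [Module.Finite ℂ V] (n : ℕ) (L : ℕ → ℕ) (y z : V)
    (ep : ℕ → V →ₗ[ℂ] ℂ) (h0 : ∀ v, ep 0 (y * v) = 0) (hepn : ep n = 0)
    (hs : ∀ i v, ep i (z ^ (L i - L (i + 1)) * v) = ep (i + 1) (y * v))
    (hne : ∀ w, (∀ i < n, ∀ v, ep i (w * v) = 0) → w = 0) :
    Module.finrank ℂ (LinearMap.range (psi n L y z)) + Module.finrank ℂ V
      ≤ n * Module.finrank ℂ V := by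
  have hinj : Function.Injective (pair n ep) := by
    rw [← LinearMap.ker_eq_bot, eq_bot_iff]
    intro w hw
    rw [LinearMap.mem_ker] at hw
    refine hne w fun i hi v => ?_
    have h := LinearMap.congr_fun hw (un n i v)
    rw [pair_apply, Finset.sum_eq_single ⟨i, hi⟩] at h
    · simpa [un] using h
    · intro j _ hj
      have : (j : ℕ) ≠ i := fun h => hj (Fin.ext h)
      simp [un, this]
    · simp
  have hann : LinearMap.range (pair n ep) ≤ (LinearMap.range (psi n L y z)).dualAnnihilator := by
    rintro _ ⟨w, rfl⟩
    rw [Submodule.mem_dualAnnihilator]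
    rintro _ ⟨f, rfl⟩
    rw [pair_apply]
    have e1 : ∀ i : Fin n, ep i (w * psi n L y z f i) =
        ep i.castSucc (y * (w * f i.castSucc)) - ep i.succ (y * (w * f i.succ)) := by
      intro i
      rw [Fin.val_succ, ← hs, Fin.val_castSucc, ← map_sub]
      congr 1
      simp [psi]; ring
    rw [Finset.sum_congr rfl fun i _ => e1 i, Finset.sum_sub_distrib]
    have s1 := Fin.sum_univ_castSucc (fun i : Fin (n + 1) => ep i (y * (w * f i)))
    have s2 := Fin.sum_univ_succ (fun i : Fin (n + 1) => ep i (y * (w * f i)))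
    rw [s2] at s1
    simp only [Fin.val_zero, h0, Fin.val_last, hepn, LinearMap.zero_apply, zero_add, add_zero] at s1
    rw [s1, sub_self]
  have h1 := Submodule.finrank_mono hann
  rw [LinearMap.finrank_range_of_inj hinj] at h1
  have h2 := Subspace.finrank_add_finrank_dualAnnihilator_eq (LinearMap.range (psi n L y z))
  rw [Module.finrank_pi_fintype] at h2
  simp at h2
  omega

lemma finrank_ker [Module.Finite ℂ V] (n : ℕ) (L : ℕ → ℕ) (y z : V)
    (h1 : n * Module.finrank ℂ V ≤
      Module.finrank ℂ (LinearMap.range (psi n L y z)) + Module.finrank ℂ V)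
    (h2 : Module.finrank ℂ (LinearMap.range (psi n L y z)) + Module.finrank ℂ V
      ≤ n * Module.finrank ℂ V) :
    Module.finrank ℂ (LinearMap.ker (psi n L y z)) = 2 * Module.finrank ℂ V := by
  have h := LinearMap.finrank_range_add_finrank_ker (psi n L y z)
  rw [Module.finrank_pi_fintype] at h
  simp [add_mul] at h
  omega

end

section

variable (I : Ideal S) (n : ℕ) (L : ℕ → ℕ)

/-- Functionals picking the top coefficient of each column. -/
noncomputable def epS (i : ℕ) : S →ₗ[ℂ] ℂ :=
  if L i = 0 then 0 else lcoeff ℂ (ex i (L i - 1))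

lemma epS_kill (hmem : ∀ p, p ∈ I ↔ ∀ d ∈ p.support, L (d 0) ≤ d 1) (i : ℕ) (p : S)
    (hp : p ∈ I) : epS L i p = 0 := by
  unfold epS
  split_ifs with h
  · rfl
  · rw [lcoeff_apply]
    by_contra hc
    have := (hmem p).1 hp _ (mem_support_iff.2 hc)
    simp at this
    omega

lemma exists_ep (hmem : ∀ p, p ∈ I ↔ ∀ d ∈ p.support, L (d 0) ≤ d 1) :
    ∃ ep : ℕ → (S ⧸ I) →ₗ[ℂ] ℂ, ∀ i p, ep i (Ideal.Quotient.mk I p) = epS L i p :=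
  ⟨fun i => ((I.restrictScalars ℂ).liftQ (epS L i)
      (fun p hp => epS_kill I L hmem i p hp)).comp
        (Submodule.Quotient.restrictScalarsEquiv ℂ I).symm.toLinearMap, fun _ _ => rfl⟩

lemma epS_mul_monomial (i a b : ℕ) (p : S) :
    epS L i (X 0 ^ a * X 1 ^ b * p) =
      if a ≤ i ∧ b + 1 ≤ L i then coeff (ex (i - a) (L i - 1 - b)) p else 0 := by
  unfold epS
  split_ifs with h h' h'
  · omega
  · rfl
  · rw [lcoeff_apply, ← ex_monomial]
    have : ex i (L i - 1) = ex a b + ex (i - a) (L i - 1 - b) := by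
      ext k; fin_cases k <;> simp <;> omega
    rw [this, coeff_monomial_mul, one_mul]
  · rw [lcoeff_apply, ← ex_monomial, coeff_monomial_mul', if_neg]
    intro hle
    have h0 := hle 0
    have h1 := hle 1
    simp at h0 h1
    omega

end

section

variable (I : Ideal S) (n : ℕ) (L : ℕ → ℕ)

lemma gen_mem (hmem : ∀ p, p ∈ I ↔ ∀ d ∈ p.support, L (d 0) ≤ d 1) (i : ℕ) :
    (X 0 ^ i * X 1 ^ L i : S) ∈ I := by
  classical
  rw [← ex_monomial, hmem, support_monomial, if_neg one_ne_zero]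
  simp

/-- Evaluation of homomorphisms at the generators. -/
noncomputable def evalGen (hmem : ∀ p, p ∈ I ↔ ∀ d ∈ p.support, L (d 0) ≤ d 1) :
    (I →ₗ[S] (S ⧸ I)) →ₗ[ℂ] (Fin (n + 1) → S ⧸ I) where
  toFun h i := h ⟨X 0 ^ (i : ℕ) * X 1 ^ L i, gen_mem I L hmem i⟩
  map_add' _ _ := rfl
  map_smul' _ _ := rfl

lemma evalGen_inj (hn : L n = 0) (hmem : ∀ p, p ∈ I ↔ ∀ d ∈ p.support, L (d 0) ≤ d 1) :
    Function.Injective (evalGen I n L hmem) := by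
  rw [← LinearMap.ker_eq_bot, eq_bot_iff]
  intro h hh
  rw [LinearMap.mem_ker] at hh
  set K : Submodule S S := (LinearMap.ker h).map I.subtype with hK
  have hg : ∀ i ≤ n, (X 0 ^ i * X 1 ^ L i : S) ∈ K := by
    intro i hi
    exact ⟨⟨_, gen_mem I L hmem i⟩, congrFun hh ⟨i, by omega⟩, rfl⟩
  have hIK : ∀ p ∈ I, p ∈ K := by
    intro p hp
    rw [← p.support_sum_monomial_coeff]
    refine sum_mem fun d hd => ?_
    have hd' := (hmem p).1 hp d hd
    rw [monomial_eq', smul_eq_C_mul]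
    rcases le_total (d 0) n with h0 | h0
    · have e : (C (coeff d p) * (X 0 ^ d 0 * X 1 ^ d 1) : S) =
          (C (coeff d p) * X 1 ^ (d 1 - L (d 0)) : S) • (X 0 ^ d 0 * X 1 ^ L (d 0) : S) := by
        conv_lhs => rw [← Nat.sub_add_cancel hd', pow_add]
        rw [smul_eq_mul]; ring
      rw [e]
      exact K.smul_mem _ (hg _ h0)
    · have e : (C (coeff d p) * (X 0 ^ d 0 * X 1 ^ d 1) : S) =
          (C (coeff d p) * X 0 ^ (d 0 - n) * X 1 ^ d 1 : S) • (X 0 ^ n * X 1 ^ L n : S) := by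
        conv_lhs => rw [← Nat.sub_add_cancel h0, pow_add]
        rw [smul_eq_mul, hn]; ring
      rw [e]
      exact K.smul_mem _ (hg _ le_rfl)
  rw [Submodule.mem_bot]
  ext1 p
  obtain ⟨q, hq, hqp⟩ := hIK p.1 p.2
  have : q = p := Subtype.ext hqp
  rw [← this]
  exact hq

lemma evalGen_range (hL : Antitone L) (hn : L n = 0)
    (hmem : ∀ p, p ∈ I ↔ ∀ d ∈ p.support, L (d 0) ≤ d 1) :
    LinearMap.range (evalGen I n L hmem) =
      LinearMap.ker (psi n L (Ideal.Quotient.mk I (X 0)) (Ideal.Quotient.mk I (X 1))) := by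
  have hsm : ∀ (s : S) (v : S ⧸ I), s • v = Ideal.Quotient.mk I s * v := fun s v =>
    Algebra.smul_def s v
  apply le_antisymm
  · rintro _ ⟨h, rfl⟩
    rw [LinearMap.mem_ker]
    ext i
    change Ideal.Quotient.mk I (X 0) * h _ - Ideal.Quotient.mk I (X 1) ^ _ * h _ = 0
    rw [← map_pow, ← hsm, ← hsm, ← map_smul, ← map_smul, sub_eq_zero]
    congr 1
    apply Subtype.ext
    simp only [Submodule.coe_smul, smul_eq_mul, Fin.val_castSucc, Fin.val_succ]
    conv_lhs => rw [← Nat.sub_add_cancel (hL (Nat.le_succ (i : ℕ))), pow_add]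
    ring
  · intro f hf
    rw [LinearMap.mem_ker] at hf
    set y := Ideal.Quotient.mk I (X 0) with hy
    set z := Ideal.Quotient.mk I (X 1) with hz
    let F : ℕ → S ⧸ I := fun a => y ^ (a - n) * f ⟨min a n, by omega⟩
    have hF : ∀ a, y * F a = z ^ (L a - L (a + 1)) * F (a + 1) := by
      intro a
      rcases lt_or_ge a n with ha | ha
      · have h := congrFun hf ⟨a, ha⟩
        change y * f _ - z ^ _ * f _ = 0 at h
        rw [sub_eq_zero] at h
        simp only [F]
        rw [Nat.sub_eq_zero_of_le ha.le, Nat.sub_eq_zero_of_le (show a + 1 ≤ n from ha)]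
        simp only [pow_zero, one_mul, min_eq_left ha.le, min_eq_left (show a + 1 ≤ n from ha)]
        exact h
      · have h1 : L a = 0 := by have := hL ha; omega
        simp only [F]
        rw [h1, Nat.succ_sub ha]
        simp only [min_eq_right ha, min_eq_right (ha.trans (Nat.le_succ a))]
        rw [Nat.zero_sub, pow_zero, pow_succ]; ring
    let H : (Fin 2 →₀ ℕ) → S ⧸ I := fun d => z ^ (d 1 - L (d 0)) * F (d 0)
    let HL : S →ₗ[ℂ] S ⧸ I := (basisMonomials (Fin 2) ℂ).constr ℂ H
    have HLm : ∀ d c, HL (monomial d c) = c • H d := by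
      intro d c
      have : (monomial d c : S) = c • basisMonomials (Fin 2) ℂ d := by
        rw [coe_basisMonomials, smul_monomial, smul_eq_mul, mul_one]
      rw [this, map_smul]
      congr 1
      exact (basisMonomials (Fin 2) ℂ).constr_basis ℂ H d
    have HX : ∀ (k : Fin 2) (d : Fin 2 →₀ ℕ), L (d 0) ≤ d 1 →
        H (Finsupp.single k 1 + d) = Ideal.Quotient.mk I (X k) * H d := by
      intro k d hd
      have hLd := hL (Nat.le_succ (d 0))
      fin_cases k
      · have e : d 1 - L (d 0 + 1) = (d 1 - L (d 0)) + (L (d 0) - L (d 0 + 1)) := by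
          simp only [Nat.succ_eq_add_one] at hLd; omega
        simp [H]
        rw [add_comm 1 (d 0), e, pow_add, mul_assoc, ← hF]
        simp only [← hy, ← hz]
        ring
      · have e : 1 + d 1 - L (d 0) = (d 1 - L (d 0)) + 1 := by omega
        simp [H]
        rw [e, pow_succ]
        simp only [← hy, ← hz]
        ring
    have HLX : ∀ (k : Fin 2) (p : S), p ∈ I →
        HL (X k * p) = Ideal.Quotient.mk I (X k) * HL p := by
      intro k p hp
      have e : p = ∑ d ∈ p.support, monomial d (coeff d p) := p.support_sum_monomial_coeff.symm
      rw [e, Finset.mul_sum, map_sum, map_sum, Finset.mul_sum]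
      refine Finset.sum_congr rfl fun d hd => ?_
      rw [X, monomial_mul, one_mul, HLm, HLm, HX k d ((hmem p).1 hp d hd), mul_smul_comm]
      rfl
    have HLS : ∀ (s p : S), p ∈ I → HL (s * p) = s • HL p := by
      intro s
      induction s using MvPolynomial.induction_on with
      | C c =>
        intro p _
        rw [← smul_eq_C_mul, map_smul, ← algebraMap_eq, algebraMap_smul]
      | add s t hs ht => intro p hp; rw [add_mul, map_add, hs p hp, ht p hp, add_smul]
      | mul_X s k hs =>
        intro p hp
        rw [mul_assoc, hs _ (I.mul_mem_left _ hp), HLX k p hp, ← hsm, mul_smul]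
    refine ⟨{ toFun := fun p => HL p.1
              map_add' := fun p q => by simp
              map_smul' := fun s p => HLS s p.1 p.2 }, ?_⟩
    ext i
    change HL (X 0 ^ (i : ℕ) * X 1 ^ L i) = f i
    rw [← ex_monomial, HLm]
    have hi : (i : ℕ) ≤ n := by have := i.2; omega
    simp [H, F, Nat.sub_eq_zero_of_le hi, min_eq_left hi]

end

lemma span_top (I : Ideal S) (T : Submodule ℂ (S ⧸ I))
    (h : ∀ a b : ℕ, Ideal.Quotient.mk I (X 0) ^ a * Ideal.Quotient.mk I (X 1) ^ b ∈ T) :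
    T = ⊤ := by
  rw [eq_top_iff]
  intro v _
  obtain ⟨p, rfl⟩ := Ideal.Quotient.mk_surjective v
  rw [← p.support_sum_monomial_coeff, map_sum]
  refine sum_mem fun d _ => ?_
  rw [monomial_eq']
  have := T.smul_mem (coeff d p) (h (d 0) (d 1))
  rw [← map_pow, ← map_pow, ← map_mul] at this
  exact this

theorem main (I : Ideal S) (hI : IsMonomialIdeal I) (hfl : Module.Finite ℂ (S ⧸ I)) :
    Module.finrank ℂ (I →ₗ[S] (S ⧸ I)) = 2 * Module.finrank ℂ (S ⧸ I) := by
  obtain ⟨n, L, hL, hn, hmem, hmem'⟩ := exists_data I hI hfl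
  rw [← LinearMap.finrank_range_of_inj (evalGen_inj I n L hn hmem),
    evalGen_range I n L hL hn hmem]
  have hcard : Fintype.card (Σ i : Fin n, Fin (L i)) ≤ Module.finrank ℂ (S ⧸ I) := by
    refine (linIndep I hmem' (fun d : (Σ i : Fin n, Fin (L i)) => ex d.1 d.2)
      ?_ ?_).fintype_card_le_finrank
    · rintro ⟨i, j⟩ ⟨i', j'⟩ h
      have h0 := DFunLike.congr_fun h 0
      have h1 := DFunLike.congr_fun h 1
      simp only [ex_zero, ex_one] at h0 h1
      obtain rfl := Fin.ext h0
      obtain rfl := Fin.ext h1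
      rfl
    · rintro ⟨i, j⟩ h
      classical
      have := (hmem _).1 h (ex i j) (by simp)
      simp only [ex_zero, ex_one] at this
      have := j.2
      omega
  obtain ⟨ep, hep⟩ := exists_ep I L hmem
  apply finrank_ker
  · exact upper n L hL hn _ _ (span_top I) hcard
  · apply lower n L _ _ ep
    · intro v
      obtain ⟨p, rfl⟩ := Ideal.Quotient.mk_surjective v
      rw [← map_mul, hep]
      have := epS_mul_monomial L 0 1 0 p
      simpa using this
    · ext v
      obtain ⟨p, rfl⟩ := Ideal.Quotient.mk_surjective v
      rw [hep, epS, if_pos hn]; rfl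
    · intro i v
      obtain ⟨p, rfl⟩ := Ideal.Quotient.mk_surjective v
      rw [← map_pow, ← map_mul, ← map_mul, hep, hep]
      have h1 := epS_mul_monomial L i 0 (L i - L (i + 1)) p
      have h2 := epS_mul_monomial L (i + 1) 1 0 p
      rw [pow_zero, one_mul] at h1
      rw [pow_zero, pow_one, mul_one] at h2
      rw [h1, h2]
      have hl : L (i + 1) ≤ L i := hL (Nat.le_succ i)
      by_cases hc : L (i + 1) = 0
      · rw [if_neg (by omega), if_neg (by omega)]
      · rw [if_pos (by omega), if_pos (by omega)]
        congr 2
        omega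
    · intro w hw
      obtain ⟨p, rfl⟩ := Ideal.Quotient.mk_surjective w
      rw [Ideal.Quotient.eq_zero_iff_mem, hmem]
      intro d hd
      by_contra hc
      have hdn : d 0 < n := by
        by_contra hge
        have := hL (not_lt.1 hge)
        omega
      have h := hw (d 0) hdn (Ideal.Quotient.mk I (X 1 ^ (L (d 0) - 1 - d 1)))
      have h1 := epS_mul_monomial L (d 0) 0 (L (d 0) - 1 - d 1) p
      rw [pow_zero, one_mul, if_pos (by omega), Nat.sub_zero,
        show L (d 0) - 1 - (L (d 0) - 1 - d 1) = d 1 by omega, ex_eta] at h1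
      rw [← map_mul, hep, mul_comm, h1] at h
      exact (mem_support_iff.1 hd) h

end HilbMon

/-- Smoothness of `Hilb^l(𝔸²)` at monomial ideals: for a monomial ideal `I`
of finite colength `l` in `S = ℂ[y,z]`, `dim_ℂ Hom_S(I, S/I) = 2l`. -/
theorem hom_dim_eq_two_colength (I : Ideal (MvPolynomial (Fin 2) ℂ))
    (hI : IsMonomialIdeal I) (l : ℕ)
    (hfl : Module.Finite ℂ (MvPolynomial (Fin 2) ℂ ⧸ I))
    (hl : Module.finrank ℂ (MvPolynomial (Fin 2) ℂ ⧸ I) = l) :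
    Module.finrank ℂ (I →ₗ[MvPolynomial (Fin 2) ℂ] (MvPolynomial (Fin 2) ℂ ⧸ I))
      = 2 * l := by
  subst hl
  exact HilbMon.main I hI hfl
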